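/- arXiv:2507.00901 — 3 statements merged into one kernel-verified Lean document; each statement's English description precedes it below -/
import Mathlib

section
/- Let 𝔳 = (V_i, v_i, v^i) be a colinked chain over a field k and let i < j be integers. Then Im(v^i_j : V_i → V_j) = Im(v^{j-1} : V_{j-1} → V_j) and Im(v^j_i : V_j → V_i) = Im(v_i : V_{i+1} → V_i); that is, the image of a composition of transfer maps equals the image of the last map applied. -/
open LinearMap Submodule Module

namespace ZChain

universe u v

variable {k : Type u} [Field k]

/-- Cast between the spaces of a representation along an equality of indices. -/
def castMap {V : ℤ → Type v} [∀ i, AddCommGroup (V i)] [∀ i, Module k (V i)]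
    {i j : ℤ} (h : i = j) : V i →ₗ[k] V j := by subst h; exact LinearMap.id

variable {V : ℤ → Type v} [∀ i, AddCommGroup (V i)] [∀ i, Module k (V i)]

/-- Iterated upward maps `v^{i+n-1} ∘ ⋯ ∘ v^i : V i → V (i+n)`. -/
def upPow (up : ∀ i : ℤ, V i →ₗ[k] V (i + 1)) : ∀ (n : ℕ) (i : ℤ), V i →ₗ[k] V (i + n)
  | 0, _ => castMap (by simp)
  | n + 1, i => castMap (by push_cast; ring) ∘ₗ up (i + n) ∘ₗ upPow up n i

/-- Iterated downward maps `v_i ∘ ⋯ ∘ v_{i+n-1} : V (i+n) → V i`. -/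
def downPow (down : ∀ i : ℤ, V (i + 1) →ₗ[k] V i) : ∀ (n : ℕ) (i : ℤ), V (i + n) →ₗ[k] V i
  | 0, _ => castMap (by simp)
  | n + 1, i => downPow down n i ∘ₗ down (i + n) ∘ₗ castMap (by push_cast; ring)

/-- The transfer map `v^i_j : V i → V j`: the identity if `i = j`, the composition of the
upward maps if `i < j`, and the composition of the downward maps if `i > j`. -/
def transfer (up : ∀ i : ℤ, V i →ₗ[k] V (i + 1)) (down : ∀ i : ℤ, V (i + 1) →ₗ[k] V i)
    (i j : ℤ) : V i →ₗ[k] V j :=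
  if h : i ≤ j then castMap (by omega) ∘ₗ upPow up (j - i).toNat i
  else downPow down (i - j).toNat j ∘ₗ castMap (by omega)

/-- A special chain: opposite arrows compose to zero. -/
def SpecialChain (up : ∀ i : ℤ, V i →ₗ[k] V (i + 1))
    (down : ∀ i : ℤ, V (i + 1) →ₗ[k] V i) : Prop :=
  ∀ i : ℤ, down i ∘ₗ up i = 0 ∧ up i ∘ₗ down i = 0

/-- A linked chain: a special chain such that the kernels of the two maps leaving any
vertex intersect trivially. -/
def LinkedChain (up : ∀ i : ℤ, V i →ₗ[k] V (i + 1))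
    (down : ∀ i : ℤ, V (i + 1) →ₗ[k] V i) : Prop :=
  SpecialChain up down ∧ ∀ i : ℤ, ker (down i) ⊓ ker (up (i + 1)) = ⊥

/-- A colinked chain: a special chain such that the images of the two maps arriving at any
vertex sum up to everything. -/
def ColinkedChain (up : ∀ i : ℤ, V i →ₗ[k] V (i + 1))
    (down : ∀ i : ℤ, V (i + 1) →ₗ[k] V i) : Prop :=
  SpecialChain up down ∧ ∀ i : ℤ, range (down (i + 1)) ⊔ range (up i) = ⊤

/-- An exact representation: the kernel of each arrow is the image of the opposite arrow. -/
def ExactRep (up : ∀ i : ℤ, V i →ₗ[k] V (i + 1))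
    (down : ∀ i : ℤ, V (i + 1) →ₗ[k] V i) : Prop :=
  ∀ i : ℤ, ker (up i) = range (down i) ∧ ker (down i) = range (up i)

/-- `H` is a support: for each vertex `i` some transfer map `v^j_i` with `j ∈ H` is surjective. -/
def RepSupport (up : ∀ i : ℤ, V i →ₗ[k] V (i + 1))
    (down : ∀ i : ℤ, V (i + 1) →ₗ[k] V i) (H : Set ℤ) : Prop :=
  ∀ i : ℤ, ∃ j ∈ H, Function.Surjective (transfer up down j i)

/-- `H` is a cosupport: for each vertex `i` some transfer map `v^i_j` with `j ∈ H` is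
injective. -/
def RepCosupport (up : ∀ i : ℤ, V i →ₗ[k] V (i + 1))
    (down : ∀ i : ℤ, V (i + 1) →ₗ[k] V i) (H : Set ℤ) : Prop :=
  ∀ i : ℤ, ∃ j ∈ H, Function.Injective (transfer up down i j)

/-- A subrepresentation: a family of subspaces preserved by all the maps. -/
def IsSubrep (up : ∀ i : ℤ, V i →ₗ[k] V (i + 1))
    (down : ∀ i : ℤ, V (i + 1) →ₗ[k] V i) (W : ∀ i : ℤ, Submodule k (V i)) : Prop :=
  ∀ i : ℤ, (∀ x ∈ W i, up i x ∈ W (i + 1)) ∧ (∀ x ∈ W (i + 1), down i x ∈ W i)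


@[simp] lemma castMap_rfl {i : ℤ} (h : i = i) : (castMap h : V i →ₗ[k] V i) = LinearMap.id := rfl

lemma castMap_comp_castMap {i j l : ℤ} (h : i = j) (h' : j = l) :
    (castMap h' : V j →ₗ[k] V l) ∘ₗ castMap h = castMap (h.trans h') := by
  subst h h'; rfl

lemma castMap_comp_up (up : ∀ i : ℤ, V i →ₗ[k] V (i + 1)) {i j : ℤ} (h : i = j)
    (h' : i + 1 = j + 1) : castMap h' ∘ₗ up i = up j ∘ₗ castMap h := by
  subst h; rfl

lemma down_comp_castMap (down : ∀ i : ℤ, V (i + 1) →ₗ[k] V i) {i j : ℤ} (h : i = j)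
    (h' : i + 1 = j + 1) : down j ∘ₗ castMap h' = castMap h ∘ₗ down i := by
  subst h; rfl

section

variable (up : ∀ i : ℤ, V i →ₗ[k] V (i + 1)) (down : ∀ i : ℤ, V (i + 1) →ₗ[k] V i)

lemma transfer_eq_upPow {i l : ℤ} (n : ℕ) (h : i + n = l) :
    transfer up down i l = castMap h ∘ₗ upPow up n i := by
  obtain rfl : (l - i).toNat = n := by omega
  exact dif_pos (by omega)

lemma transfer_eq_downPow {i l : ℤ} (n : ℕ) (h : l = i + n) :
    transfer up down l i = downPow down n i ∘ₗ castMap h := by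
  obtain rfl | hn := Nat.eq_zero_or_pos n
  · rw [transfer_eq_upPow up down 0 (by simpa using h)]
    simp only [upPow, downPow, castMap_comp_castMap]
  · obtain rfl : (l - i).toNat = n := by omega
    exact dif_neg (by omega)

@[simp] lemma transfer_self (i : ℤ) : transfer up down i i = LinearMap.id := by
  rw [transfer_eq_upPow up down 0 (by simp), upPow, castMap_comp_castMap, castMap_rfl]

lemma transfer_add_one_right {i l : ℤ} (h : i ≤ l) :
    transfer up down i (l + 1) = up l ∘ₗ transfer up down i l := by
  obtain ⟨n, rfl⟩ := Int.le.dest h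
  rw [transfer_eq_upPow up down (n + 1) (by push_cast; ring), transfer_eq_upPow up down n rfl,
    upPow, ← LinearMap.comp_assoc, castMap_comp_castMap, castMap_rfl, castMap_rfl]
  rfl

lemma transfer_add_one_left {i l : ℤ} (h : i ≤ l) :
    transfer up down (l + 1) i = transfer up down l i ∘ₗ down l := by
  obtain ⟨n, rfl⟩ := Int.le.dest h
  rw [transfer_eq_downPow up down (n + 1) (by push_cast; ring), transfer_eq_downPow up down n rfl,
    downPow, LinearMap.comp_assoc, LinearMap.comp_assoc, castMap_comp_castMap, castMap_rfl,
    castMap_rfl]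
  rfl

end

/-- A linear map killing one of two submodules spanning its domain has the same range as its
restriction to the other one. -/
lemma map_eq_range_of_sup_eq_top {M N : Type*} [AddCommGroup M] [Module k M] [AddCommGroup N]
    [Module k N] {p q : Submodule k M} (f : M →ₗ[k] N) (h : p ⊔ q = ⊤) (hp : p ≤ ker f) :
    q.map f = range f := by
  rw [range_eq_map, ← h, Submodule.map_sup, LinearMap.le_ker_iff_map.1 hp, bot_sup_eq]

/-- For a colinked chain, the image of a composition of transfer maps is the
image of the last map applied: for `i < j`, `Im (v^i_j) = Im (v^{j-1})` (stated with
`j = l + 1`, `i ≤ l`) and `Im (v^j_i) = Im (v_i)`. -/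
theorem range_transfer_of_colinkedChain
    (V : ℤ → Type v) [∀ i, AddCommGroup (V i)] [∀ i, Module k (V i)]
    [∀ i, FiniteDimensional k (V i)]
    (up : ∀ i : ℤ, V i →ₗ[k] V (i + 1)) (down : ∀ i : ℤ, V (i + 1) →ₗ[k] V i)
    (hcc : ColinkedChain up down) :
    (∀ i l : ℤ, i ≤ l →
      LinearMap.range (transfer up down i (l + 1)) = LinearMap.range (up l)) ∧
    (∀ i j : ℤ, i < j →
      LinearMap.range (transfer up down j i) = LinearMap.range (down i)) := by
  obtain ⟨hs, hc⟩ := hcc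
  constructor
  · intro i l h
    induction l, h using Int.leInduction with
    | base => simp [transfer_add_one_right]
    | succ l h ih =>
      rw [transfer_add_one_right up down (by omega), range_comp, ih]
      exact map_eq_range_of_sup_eq_top _ (hc l) (range_le_ker_iff.2 (hs (l + 1)).2)
  · intro i j h
    induction j, Int.add_one_le_of_lt h using Int.leInduction with
    | base => simp [transfer_add_one_left]
    | succ l h ih =>
      rw [transfer_add_one_left up down (by omega), range_comp, ← ih (by omega)]
      obtain ⟨m, rfl⟩ : ∃ m, l = m + 1 := ⟨l - 1, by ring⟩
      refine map_eq_range_of_sup_eq_top _ ((sup_comm _ _).trans (hc m)) (range_le_ker_iff.2 ?_)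
      rw [transfer_add_one_left up down (by omega), comp_assoc, (hs m).1, comp_zero]

end ZChain
end

section
/- Let 𝔴 = (W_i, w_i, w^i) be a representation of the ℤ-quiver of pure dimension 1 over a field k, and set a^i = a^i(𝔴) and a_i = a_i(𝔴). Then 𝔴 is a colinked chain with finite cosupport if and only if there exists i ∈ ℤ such that a^i · a_i = 0, (a^j, a_j) = (1,0) for every j < i, and (a^j, a_j) = (0,1) for every j > i. -/
open LinearMap Submodule Module

namespace ZChain

universe u v

variable {k : Type u} [Field k]

variable {V : ℤ → Type v} [∀ i, AddCommGroup (V i)] [∀ i, Module k (V i)]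

theorem castMap_injective {i j : ℤ} (h : i = j) :
    Function.Injective (castMap (k := k) (V := V) h) := by
  subst h
  exact Function.injective_id

theorem upPow_injective {up : ∀ i : ℤ, V i →ₗ[k] V (i + 1)} (n : ℕ) (i : ℤ)
    (h : ∀ l, i ≤ l → l < i + n → Function.Injective (up l)) :
    Function.Injective (upPow up n i) := by
  induction n with
  | zero => exact castMap_injective _
  | succ n ih =>
    exact (castMap_injective _).comp ((h _ (by omega) (by push_cast; omega)).comp
      (ih fun l h₁ h₂ => h l h₁ (by push_cast; omega)))

theorem downPow_injective {down : ∀ i : ℤ, V (i + 1) →ₗ[k] V i} (n : ℕ) (i : ℤ)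
    (h : ∀ l, i ≤ l → l < i + n → Function.Injective (down l)) :
    Function.Injective (downPow down n i) := by
  induction n with
  | zero => exact castMap_injective _
  | succ n ih =>
    exact (ih fun l h₁ h₂ => h l h₁ (by push_cast; omega)).comp
      ((h _ (by omega) (by push_cast; omega)).comp (castMap_injective _))

theorem transfer_injective_of_le {up : ∀ i : ℤ, V i →ₗ[k] V (i + 1)}
    (down : ∀ i : ℤ, V (i + 1) →ₗ[k] V i) {i j : ℤ} (hij : i ≤ j)
    (h : ∀ l, i ≤ l → l < j → Function.Injective (up l)) :
    Function.Injective (transfer up down i j) := by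
  rw [transfer, dif_pos hij]
  exact (castMap_injective _).comp
    (upPow_injective _ _ fun l h₁ h₂ => h l h₁ (by omega))

theorem transfer_injective_of_ge (up : ∀ i : ℤ, V i →ₗ[k] V (i + 1))
    {down : ∀ i : ℤ, V (i + 1) →ₗ[k] V i} {i j : ℤ} (hji : j ≤ i)
    (h : ∀ l, j ≤ l → l < i → Function.Injective (down l)) :
    Function.Injective (transfer up down i j) := by
  rcases hji.eq_or_lt with rfl | hlt
  · exact transfer_injective_of_le down le_rfl fun l h₁ h₂ => by omega
  · rw [transfer, dif_neg hlt.not_ge]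
    exact (downPow_injective _ _ fun l h₁ h₂ => h l h₁ (by omega)).comp
      (castMap_injective _)

theorem transfer_eq_zero_of_lt {up : ∀ i : ℤ, V i →ₗ[k] V (i + 1)}
    (down : ∀ i : ℤ, V (i + 1) →ₗ[k] V i) {i j : ℤ} (hij : i < j)
    (h : ∀ l, up l = 0) : transfer up down i j = 0 := by
  obtain ⟨n, hn⟩ : ∃ n, (j - i).toNat = n + 1 := ⟨(j - i).toNat - 1, by omega⟩
  have hz : upPow up (j - i).toNat i = 0 := by
    rw [hn, upPow, h, zero_comp, comp_zero]
  rw [transfer, dif_pos hij.le, hz, comp_zero]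

theorem transfer_eq_zero_of_gt (up : ∀ i : ℤ, V i →ₗ[k] V (i + 1))
    {down : ∀ i : ℤ, V (i + 1) →ₗ[k] V i} {i j : ℤ} (hji : j < i)
    (h : ∀ l, down l = 0) : transfer up down i j = 0 := by
  obtain ⟨n, hn⟩ : ∃ n, (i - j).toNat = n + 1 := ⟨(i - j).toNat - 1, by omega⟩
  have hz : downPow down (i - j).toNat j = 0 := by
    rw [hn, downPow, h, zero_comp, comp_zero]
  rw [transfer, dif_neg hji.not_ge, hz, zero_comp]

theorem bijective_of_ne_zero_of_finrank_eq_one {E F : Type*} [AddCommGroup E] [Module k E]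
    [AddCommGroup F] [Module k F] (hE : finrank k E = 1) (hF : finrank k F = 1)
    {f : E →ₗ[k] F} (hf : f ≠ 0) : Function.Bijective f := by
  have := isSimpleModule_iff_finrank_eq_one.mpr hE
  have := isSimpleModule_iff_finrank_eq_one.mpr hF
  exact bijective_of_ne_zero hf

/-- With one-dimensional spaces, a special chain has a vanishing map in each opposite pair. -/
theorem specialChain_iff_of_finrank_eq_one {up : ∀ i : ℤ, V i →ₗ[k] V (i + 1)}
    {down : ∀ i : ℤ, V (i + 1) →ₗ[k] V i} (hV : ∀ i, finrank k (V i) = 1) :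
    SpecialChain up down ↔ ∀ i, up i = 0 ∨ down i = 0 := by
  refine forall_congr' fun i => ⟨fun ⟨h, _⟩ => ?_, ?_⟩
  · by_contra! hne
    have hinj := (bijective_of_ne_zero_of_finrank_eq_one (hV _) (hV _) hne.2).injective
    refine hne.1 (LinearMap.ext fun x => hinj ?_)
    simpa using LinearMap.congr_fun h x
  · rintro (h | h) <;> simp [h]

/-- With one-dimensional spaces, the colinked condition says that one of the two maps arriving
at each vertex does not vanish. -/
theorem range_sup_range_eq_top_iff_of_finrank_eq_one {up : ∀ i : ℤ, V i →ₗ[k] V (i + 1)}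
    {down : ∀ i : ℤ, V (i + 1) →ₗ[k] V i} (hV : ∀ i, finrank k (V i) = 1) (i : ℤ) :
    range (down (i + 1)) ⊔ range (up i) = ⊤ ↔ down (i + 1) ≠ 0 ∨ up i ≠ 0 := by
  constructor
  · intro h
    by_contra! hz
    have := nontrivial_of_finrank_pos (R := k) (M := V (i + 1)) (by rw [hV]; exact one_pos)
    simp [hz.1, hz.2] at h
  · rintro (h | h)
    · rw [range_eq_top.mpr (bijective_of_ne_zero_of_finrank_eq_one (hV _) (hV _) h).surjective,
        top_sup_eq]
    · rw [range_eq_top.mpr (bijective_of_ne_zero_of_finrank_eq_one (hV _) (hV _) h).surjective,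
        sup_top_eq]

/-- A representation of pure dimension 1 is a colinked chain with finite
cosupport if and only if there is a vertex `i` with `a^i · a_i = 0`, `(a^j, a_j) = (1,0)` for
`j < i` and `(a^j, a_j) = (0,1)` for `j > i` (where `a^j = 0` iff `w^j = 0` and `a_j = 0`
iff `w_j = 0`). -/
theorem pure_one_colinkedChain_finite_cosupport_iff
    (W : ℤ → Type v) [∀ i, AddCommGroup (W i)] [∀ i, Module k (W i)]
    [∀ i, FiniteDimensional k (W i)]
    (up : ∀ i : ℤ, W i →ₗ[k] W (i + 1)) (down : ∀ i : ℤ, W (i + 1) →ₗ[k] W i)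
    (hpure : ∀ i : ℤ, Module.finrank k (W i) = 1) :
    (ColinkedChain up down ∧ ∃ H : Finset ℤ, RepCosupport up down ↑H) ↔
      ∃ i : ℤ, (up i = 0 ∨ down i = 0) ∧
        (∀ j : ℤ, j < i → up j ≠ 0 ∧ down j = 0) ∧
        (∀ j : ℤ, i < j → up j = 0 ∧ down j ≠ 0) := by
  have hnt (i : ℤ) : Nontrivial (W i) :=
    nontrivial_of_finrank_pos (R := k) (by rw [hpure]; exact one_pos)
  have htransfer {i j : ℤ} (h : Function.Injective (transfer up down i j)) :
      transfer up down i j ≠ 0 := by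
    intro h₀
    obtain ⟨x, hx⟩ := exists_ne (0 : W i)
    exact hx (h (by simp [h₀]))
  simp only [ColinkedChain, specialChain_iff_of_finrank_eq_one hpure,
    range_sup_range_eq_top_iff_of_finrank_eq_one hpure]
  constructor
  · rintro ⟨⟨hs, hc⟩, H, hH⟩
    have hstep (j : ℤ) (hj : up j = 0) : up (j + 1) = 0 ∧ down (j + 1) ≠ 0 := by
      have hd := (hc j).resolve_right (not_not.mpr hj)
      exact ⟨(hs _).resolve_right hd, hd⟩
    have hmono {i j : ℤ} (hij : i ≤ j) (hi : up i = 0) : up j = 0 := by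
      induction j, hij using Int.leInduction with
      | base => exact hi
      | succ j _ ih => exact (hstep j ih).1
    have hex : ∃ i, up i = 0 := by
      by_contra! hne
      obtain ⟨b, hb⟩ := H.bddAbove
      obtain ⟨j, hjH, hj⟩ := hH (b + 1)
      exact htransfer hj (transfer_eq_zero_of_gt up (Int.lt_add_one_of_le (hb hjH))
        fun l => (hs l).resolve_left (hne l))
    have hbdd : ∃ b, ∀ i, up i = 0 → b ≤ i := by
      obtain ⟨b, hb⟩ := H.bddBelow
      obtain ⟨j, hjH, hj⟩ := hH (b - 1)
      by_contra! hlow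
      refine htransfer hj (transfer_eq_zero_of_lt down (by have := hb hjH; omega) fun l => ?_)
      obtain ⟨m, hm, hml⟩ := hlow l
      exact hmono hml.le hm
    obtain ⟨i, hi, hmin⟩ := Int.exists_least_of_bdd hbdd hex
    refine ⟨i, Or.inl hi, fun j hj => ?_, fun j hj => ?_⟩
    · have hu : up j ≠ 0 := fun h => (hmin j h).not_gt hj
      exact ⟨hu, (hs j).resolve_left hu⟩
    · have h := hstep (j - 1) (hmono (by omega) hi)
      rwa [sub_add_cancel] at h
  · rintro ⟨i, hi, hlt, hgt⟩
    refine ⟨⟨fun j => ?_, fun j => ?_⟩, {i, i + 1}, fun j => ?_⟩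
    · rcases lt_trichotomy j i with h | rfl | h
      · exact Or.inr (hlt j h).2
      · exact hi
      · exact Or.inl (hgt j h).1
    · rcases lt_or_ge j i with h | h
      · exact Or.inr (hlt j h).1
      · exact Or.inl (hgt (j + 1) (by omega)).2
    · rcases le_or_gt j i with h | h
      · exact ⟨i, by simp, transfer_injective_of_le down h fun l _ hl =>
          (bijective_of_ne_zero_of_finrank_eq_one (hpure _) (hpure _) (hlt l hl).1).injective⟩
      · exact ⟨i + 1, by simp, transfer_injective_of_ge up h fun l hl _ =>
          (bijective_of_ne_zero_of_finrank_eq_one (hpure _) (hpure _)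
            (hgt l (by omega)).2).injective⟩

end ZChain
end

section
/- Let 𝔴 = (W_i, w_i, w^i) be a representation of the ℤ-quiver of pure dimension 1 over a field k, and set a^i = a^i(𝔴) and a_i = a_i(𝔴). Then 𝔴 is an exact linked chain with finite support if and only if there exists i ∈ ℤ such that (a^j, a_j) = (0,1) for every j < i and (a^j, a_j) = (1,0) for every j ≥ i. -/
open LinearMap Submodule Module

namespace ZChain

universe u v

variable {k : Type u} [Field k]

variable {V : ℤ → Type v} [∀ i, AddCommGroup (V i)] [∀ i, Module k (V i)]

theorem castMap_surjective {i j : ℤ} (h : i = j) :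
    Function.Surjective (castMap (k := k) (V := V) h) := by
  subst h
  exact Function.surjective_id

theorem upPow_surjective (up : ∀ i : ℤ, V i →ₗ[k] V (i + 1)) (n : ℕ) (i : ℤ)
    (h : ∀ j, i ≤ j → Function.Surjective (up j)) : Function.Surjective (upPow up n i) := by
  induction n with
  | zero => exact castMap_surjective _
  | succ n ih =>
    rw [upPow, LinearMap.coe_comp, LinearMap.coe_comp]
    exact (castMap_surjective _).comp ((h _ (by omega)).comp ih)

theorem downPow_surjective (down : ∀ i : ℤ, V (i + 1) →ₗ[k] V i) (n : ℕ) (i : ℤ)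
    (h : ∀ j, j < i + n → Function.Surjective (down j)) :
    Function.Surjective (downPow down n i) := by
  induction n with
  | zero => exact castMap_surjective _
  | succ n ih =>
    rw [downPow, LinearMap.coe_comp, LinearMap.coe_comp]
    exact (ih fun j hj => h j (by push_cast; omega)).comp
      ((h _ (by push_cast; omega)).comp (castMap_surjective _))

/-- A nonzero upward transfer map between distinct vertices has a nonzero upward arrow. -/
theorem exists_up_ne_zero_of_transfer_ne_zero (up : ∀ i : ℤ, V i →ₗ[k] V (i + 1))
    (down : ∀ i : ℤ, V (i + 1) →ₗ[k] V i) {i j : ℤ} (hij : i < j)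
    (h : transfer up down i j ≠ 0) : ∃ l, up l ≠ 0 := by
  contrapose! h
  rw [transfer, dif_pos hij.le]
  have hn : ∀ n : ℕ, n ≠ 0 → upPow up n i = 0
    | 0, hn => absurd rfl hn
    | n + 1, _ => by rw [upPow, h, LinearMap.zero_comp, LinearMap.comp_zero]
  rw [hn _ (by omega), LinearMap.comp_zero]

/-- A nonzero downward transfer map between distinct vertices has a nonzero downward arrow. -/
theorem exists_down_ne_zero_of_transfer_ne_zero (up : ∀ i : ℤ, V i →ₗ[k] V (i + 1))
    (down : ∀ i : ℤ, V (i + 1) →ₗ[k] V i) {i j : ℤ} (hij : j < i)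
    (h : transfer up down i j ≠ 0) : ∃ l, down l ≠ 0 := by
  contrapose! h
  rw [transfer, dif_neg hij.not_ge]
  have hn : ∀ n : ℕ, n ≠ 0 → downPow down n j = 0
    | 0, hn => absurd rfl hn
    | n + 1, _ => by rw [downPow, h, LinearMap.zero_comp, LinearMap.comp_zero]
  rw [hn _ (by omega), LinearMap.zero_comp]

/-- The vertex `i` alone supports a representation whose arrows pointing away from `i` are
surjective. -/
theorem repSupport_singleton (up : ∀ i : ℤ, V i →ₗ[k] V (i + 1))
    (down : ∀ i : ℤ, V (i + 1) →ₗ[k] V i) (i : ℤ)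
    (hup : ∀ j, i ≤ j → Function.Surjective (up j))
    (hdown : ∀ j, j < i → Function.Surjective (down j)) : RepSupport up down {i} := by
  intro j
  refine ⟨i, rfl, ?_⟩
  by_cases hij : i ≤ j
  · rw [transfer, dif_pos hij, LinearMap.coe_comp]
    exact (castMap_surjective _).comp (upPow_surjective up _ i hup)
  · rw [transfer, dif_neg hij, LinearMap.coe_comp]
    exact (downPow_surjective down _ j fun l hl => hdown l (by omega)).comp
      (castMap_surjective _)

/-- Between simple modules, a pair of opposite maps is exact in both directions if and only if
exactly one of them is zero. -/
theorem ker_eq_range_and_iff_of_isSimpleModule {M N : Type*} [AddCommGroup M] [Module k M]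
    [AddCommGroup N] [Module k N] [IsSimpleModule k M] [IsSimpleModule k N]
    (f : M →ₗ[k] N) (g : N →ₗ[k] M) :
    (ker f = range g ∧ ker g = range f) ↔ (f = 0 ∧ g ≠ 0) ∨ (f ≠ 0 ∧ g = 0) := by
  have := IsSimpleModule.nontrivial k M
  have := IsSimpleModule.nontrivial k N
  rcases f.bijective_or_eq_zero with hf | rfl <;> rcases g.bijective_or_eq_zero with hg | rfl
  · have hf0 : f ≠ 0 := by rintro rfl; simpa using ker_eq_bot.2 hf.1
    have hg0 : g ≠ 0 := by rintro rfl; simpa using ker_eq_bot.2 hg.1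
    simp [hf0, hg0, ker_eq_bot.2 hf.1, range_eq_top.2 hg.2]
  · have hf0 : f ≠ 0 := by rintro rfl; simpa using ker_eq_bot.2 hf.1
    simp [hf0, ker_eq_bot.2 hf.1, range_eq_top.2 hf.2]
  · have hg0 : g ≠ 0 := by rintro rfl; simpa using ker_eq_bot.2 hg.1
    simp [hg0, ker_eq_bot.2 hg.1, range_eq_top.2 hg.2]
  · simp

/-- A representation of pure dimension 1 is an exact linked chain with
finite support if and only if there is a vertex `i` with `(a^j, a_j) = (0,1)` for `j < i`
and `(a^j, a_j) = (1,0)` for `j ≥ i` (where `a^j = 0` iff `w^j = 0` and `a_j = 0` iff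
`w_j = 0`). -/
theorem pure_one_exact_linkedChain_finite_support_iff
    (W : ℤ → Type v) [∀ i, AddCommGroup (W i)] [∀ i, Module k (W i)]
    [∀ i, FiniteDimensional k (W i)]
    (up : ∀ i : ℤ, W i →ₗ[k] W (i + 1)) (down : ∀ i : ℤ, W (i + 1) →ₗ[k] W i)
    (hpure : ∀ i : ℤ, Module.finrank k (W i) = 1) :
    (ExactRep up down ∧ LinkedChain up down ∧ ∃ H : Finset ℤ, RepSupport up down ↑H) ↔
      ∃ i : ℤ, (∀ j : ℤ, j < i → up j = 0 ∧ down j ≠ 0) ∧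
        (∀ j : ℤ, i ≤ j → up j ≠ 0 ∧ down j = 0) := by
  have hs : ∀ i, IsSimpleModule k (W i) := fun i => isSimpleModule_iff_finrank_eq_one.2 (hpure i)
  have hnt : ∀ i, Nontrivial (W i) := fun i => IsSimpleModule.nontrivial k (W i)
  constructor
  · rintro ⟨hex, ⟨-, hlink⟩, H, hH⟩
    have hiff := fun i => (ker_eq_range_and_iff_of_isSimpleModule (up i) (down i)).1 (hex i)
    have hstep : ∀ i, up i ≠ 0 → up (i + 1) ≠ 0 := by
      intro i hi h
      have hd : down i = 0 := by have := hiff i; tauto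
      have := hlink i
      rw [hd, h] at this
      simp at this
    have hmono : ∀ i j, i ≤ j → up i ≠ 0 → up j ≠ 0 := fun i j hij hi =>
      Int.leInduction (motive := fun j _ => up j ≠ 0) hi (fun j _ => hstep j) j hij
    have hne : ∀ i j, Function.Surjective (transfer up down i j) → transfer up down i j ≠ 0 := by
      intro i j h h0
      rw [h0] at h
      obtain ⟨x, hx⟩ := exists_ne (0 : W j)
      obtain ⟨y, rfl⟩ := h x
      exact hx rfl
    obtain ⟨b, hb⟩ : ∃ b, up b ≠ 0 := by
      obtain ⟨M, hM⟩ := H.bddAbove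
      obtain ⟨j, hj, hsurj⟩ := hH (M + 1)
      exact exists_up_ne_zero_of_transfer_ne_zero up down (Int.lt_add_one_of_le (hM hj))
        (hne _ _ hsurj)
    obtain ⟨c, hc⟩ : ∃ c, down c ≠ 0 := by
      obtain ⟨m, hm⟩ := H.bddBelow
      obtain ⟨j, hj, hsurj⟩ := hH (m - 1)
      exact exists_down_ne_zero_of_transfer_ne_zero up down (Int.sub_one_lt_of_le (hm hj))
        (hne _ _ hsurj)
    obtain ⟨i, hi, hmin⟩ := Int.exists_least_of_bdd (P := fun i => up i ≠ 0)
      ⟨c, fun z hz => by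
        by_contra! hlt
        have := hmono z c hlt.le hz
        have := hiff c
        tauto⟩ ⟨b, hb⟩
    refine ⟨i, fun j hj => ?_, fun j hj => ?_⟩
    · have h0 : up j = 0 := by
        by_contra h
        exact absurd (hmin j h) hj.not_ge
      have := hiff j
      tauto
    · have := hmono i j hj hi
      have := hiff j
      tauto
  · rintro ⟨i, hlt, hge⟩
    have hex : ExactRep up down := fun j => by
      rw [ker_eq_range_and_iff_of_isSimpleModule]
      rcases lt_or_ge j i with h | h
      · exact Or.inl (hlt j h)
      · exact Or.inr (hge j h)
    refine ⟨hex, ⟨fun j => ?_, fun j => ?_⟩, {i}, ?_⟩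
    · exact ⟨range_le_ker_iff.1 (hex j).2.ge, range_le_ker_iff.1 (hex j).1.ge⟩
    · rcases lt_or_ge j i with h | h
      · rw [ker_eq_bot.2 ((down j).injective_or_eq_zero.resolve_right (hlt j h).2), bot_inf_eq]
      · rw [ker_eq_bot.2 ((up (j + 1)).injective_or_eq_zero.resolve_right
          (hge (j + 1) (by omega)).1), inf_bot_eq]
    · rw [Finset.coe_singleton]
      exact repSupport_singleton up down i
        (fun j hj => (up j).surjective_or_eq_zero.resolve_right (hge j hj).1)
        (fun j hj => (down j).surjective_or_eq_zero.resolve_right (hlt j hj).2)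

end ZChain
end
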